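/- Let (P_s)_{s∈ℝ₊} be a path-dependent system of projectors. For every (s,η) ∈ ℝ₊×Ω, the set function F ↦ P_s[1_F](η) on F is a probability measure ℙ^{s,η} on (Ω,F), and the family (ℙ^{s,η})_{(s,η)∈ℝ₊×Ω} so defined is a path-dependent canonical class. -/

import Mathlib

open MeasureTheory Filter Topology Set
open scoped NNReal ENNReal

noncomputable section

/-- A function indexed by `ℝ≥0` is *cadlag* if it is right-continuous and has
left limits at every positive time. -/
def IsCadlag {X : Type*} [TopologicalSpace X] (f : ℝ≥0 → X) : Prop :=
  (∀ t : ℝ≥0, Tendsto f (𝓝[Set.Ici t] t) (𝓝 (f t))) ∧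
    ∀ t : ℝ≥0, 0 < t → ∃ l : X, Tendsto f (𝓝[Set.Iio t] t) (𝓝 l)

variable (E : Type*) [TopologicalSpace E] [MeasurableSpace E]

/-- The canonical path space `Ω = D(ℝ₊, E)` of cadlag paths with values in `E`. -/
def PathOmega := {f : ℝ≥0 → E // IsCadlag f}

/-- The canonical σ-field `𝓕 = σ(X_r ; r ≥ 0)` on the path space. -/
instance instPathOmegaMS : MeasurableSpace (PathOmega E) :=
  ⨆ r : ℝ≥0, MeasurableSpace.comap (fun ω : PathOmega E => ω.1 r) inferInstance

/-- The initial filtration `𝓕^o_t = σ(X_r ; r ≤ t)`. -/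
def Fot (t : ℝ≥0) : MeasurableSpace (PathOmega E) :=
  ⨆ r ∈ Set.Iic t, MeasurableSpace.comap (fun ω : PathOmega E => ω.1 r) inferInstance

/-- The canonical (right-continuous) filtration `𝓕_t = ⋂_{s > t} 𝓕^o_s`. -/
def Ft (t : ℝ≥0) : MeasurableSpace (PathOmega E) :=
  ⨅ u ∈ Set.Ioi t, Fot E u

variable {E}

/-- A *path-dependent canonical class*. -/
structure IsPathCanonicalClass (P : ℝ≥0 → PathOmega E → Measure (PathOmega E)) : Prop where
  isProb : ∀ s η, IsProbabilityMeasure (P s η)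
  starts : ∀ (s : ℝ≥0) (η : PathOmega E), P s η {ω | ∀ r ≤ s, ω.1 r = η.1 r} = 1
  fos_meas : ∀ (s : ℝ≥0) (F : Set (PathOmega E)), MeasurableSet F →
    Measurable[Fot E s] fun η => P s η F
  cond : ∀ (s : ℝ≥0) (η : PathOmega E) (t : ℝ≥0), s ≤ t →
    ∀ F : Set (PathOmega E), MeasurableSet F →
      ∀ G : Set (PathOmega E), MeasurableSet[Fot E t] G →
        ∫⁻ ω in G, P t ω F ∂(P s η) = P s η (F ∩ G)

variable (E)


/-- `B_b(Ω)`: bounded measurable real functions on the path space. -/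
def BB (f : PathOmega E → ℝ) : Prop :=
  Measurable f ∧ ∃ C : ℝ, ∀ ω, |f ω| ≤ C

/-- `B^s_b(Ω)`: bounded `𝓕^o_s`-measurable real functions on the path space. -/
def BBs (s : ℝ≥0) (f : PathOmega E → ℝ) : Prop :=
  Measurable[Fot E s] f ∧ ∃ C : ℝ, ∀ ω, |f ω| ≤ C

/-- A *path-dependent system of projectors*: a family of positivity preserving,
monotonic linear operators on `B_b(Ω)` such that `P_s` is the identity on
`B^s_b(Ω)`, maps `B_b(Ω)` into `B^s_b(Ω)`, and `P_s ∘ P_t = P_s` for `s ≤ t`. -/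
structure IsProjSystem (Q : ℝ≥0 → (PathOmega E → ℝ) → PathOmega E → ℝ) : Prop where
  mapsTo : ∀ (s : ℝ≥0) (f : PathOmega E → ℝ), BB E f → BBs E s (Q s f)
  add : ∀ (s : ℝ≥0) (f g : PathOmega E → ℝ), BB E f → BB E g →
    Q s (fun ω => f ω + g ω) = fun ω => Q s f ω + Q s g ω
  smul : ∀ (s : ℝ≥0) (c : ℝ) (f : PathOmega E → ℝ), BB E f →
    Q s (fun ω => c * f ω) = fun ω => c * Q s f ω
  pos : ∀ (s : ℝ≥0) (f : PathOmega E → ℝ), BB E f → (∀ ω, 0 ≤ f ω) → ∀ ω, 0 ≤ Q s f ω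
  monotonic : ∀ (s : ℝ≥0) (f : ℕ → PathOmega E → ℝ) (g : PathOmega E → ℝ),
    (∀ n, BB E (f n)) → BB E g → (∀ ω, Monotone fun n => f n ω) →
    (∀ ω, Tendsto (fun n => f n ω) atTop (𝓝 (g ω))) →
    ∀ ω, Tendsto (fun n => Q s (f n) ω) atTop (𝓝 (Q s g ω))
  restrict_id : ∀ (s : ℝ≥0) (f : PathOmega E → ℝ), BBs E s f → Q s f = f
  comp : ∀ (s t : ℝ≥0), s ≤ t → ∀ f : PathOmega E → ℝ, BB E f → Q s (Q t f) = Q s f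

/-- The operators associated with a family of measures: `P_s[f](η) = E^{s,η}[f]`. -/
def projOf (P : ℝ≥0 → PathOmega E → Measure (PathOmega E)) :
    ℝ≥0 → (PathOmega E → ℝ) → PathOmega E → ℝ :=
  fun s f η => ∫ ω, f ω ∂(P s η)

/-- A *monotonic functional*: a positive linear functional on the bounded measurable real
functions which is continuous along bounded nondecreasing sequences. -/
structure IsMonotonicFunctional {α : Type*} [MeasurableSpace α] (L : (α → ℝ) → ℝ) : Prop where
  add : ∀ f g : α → ℝ, Measurable f → (∃ C, ∀ x, |f x| ≤ C) → Measurable g →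
    (∃ C, ∀ x, |g x| ≤ C) → L (fun x => f x + g x) = L f + L g
  smul : ∀ (c : ℝ) (f : α → ℝ), Measurable f → (∃ C, ∀ x, |f x| ≤ C) →
    L (fun x => c * f x) = c * L f
  nonneg : ∀ f : α → ℝ, Measurable f → (∃ C, ∀ x, |f x| ≤ C) → (∀ x, 0 ≤ f x) → 0 ≤ L f
  tendsto : ∀ (f : ℕ → α → ℝ) (g : α → ℝ), (∀ n, Measurable (f n)) →
    (∀ n, ∃ C, ∀ x, |f n x| ≤ C) → Measurable g → (∃ C, ∀ x, |g x| ≤ C) →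
    (∀ x, Monotone fun n => f n x) → (∀ x, Tendsto (fun n => f n x) atTop (𝓝 (g x))) →
    Tendsto (fun n => L (f n)) atTop (𝓝 (L g))

lemma exists_abs_indicator_one_le {α : Type*} (F : Set α) :
    ∃ C : ℝ, ∀ x, |F.indicator (fun _ => (1 : ℝ)) x| ≤ C := by
  refine ⟨1, fun x => ?_⟩
  by_cases hx : x ∈ F <;> simp [hx]

namespace IsMonotonicFunctional

variable {α : Type*} [MeasurableSpace α] {L : (α → ℝ) → ℝ}

lemma map_zero (hL : IsMonotonicFunctional L) : L (fun _ => 0) = 0 := by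
  simpa using hL.smul 0 (fun _ => 0) measurable_const ⟨0, by simp⟩

lemma map_sum (hL : IsMonotonicFunctional L) {f : ℕ → α → ℝ} (hf : ∀ n, Measurable (f n))
    (hb : ∀ n, ∃ C, ∀ x, |f n x| ≤ C) (n : ℕ) :
    L (fun x => ∑ i ∈ Finset.range n, f i x) = ∑ i ∈ Finset.range n, L (f i) := by
  induction n with
  | zero => simpa using hL.map_zero
  | succ n ih =>
    choose C hC using hb
    simp only [Finset.sum_range_succ]
    rw [hL.add _ _ (by fun_prop) ⟨∑ i ∈ Finset.range n, C i, fun x => ?_⟩ (hf n) ⟨C n, hC n⟩, ih]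
    exact (Finset.abs_sum_le_sum_abs _ _).trans (Finset.sum_le_sum fun i _ => hC i x)

lemma indicator_nonneg (hL : IsMonotonicFunctional L) {F : Set α} (hF : MeasurableSet F) :
    0 ≤ L (F.indicator fun _ => 1) :=
  hL.nonneg _ (measurable_const.indicator hF) (exists_abs_indicator_one_le F)
    fun _ => Set.indicator_nonneg (fun _ _ => zero_le_one) _

lemma hasSum_indicator (hL : IsMonotonicFunctional L) {F : ℕ → Set α}
    (hF : ∀ n, MeasurableSet (F n)) (hd : Pairwise (Function.onFun Disjoint F)) :
    HasSum (fun n => L ((F n).indicator fun _ => 1)) (L ((⋃ n, F n).indicator fun _ => 1)) := by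
  rw [hasSum_iff_tendsto_nat_of_nonneg fun n => hL.indicator_nonneg (hF n)]
  have hm : ∀ n, Measurable ((F n).indicator fun _ => (1 : ℝ)) := fun n =>
    measurable_const.indicator (hF n)
  simp_rw [← hL.map_sum hm fun n => exists_abs_indicator_one_le (F n)]
  refine hL.tendsto _ _ (fun n => by fun_prop) (fun n => ⟨n, fun x => ?_⟩)
    (measurable_const.indicator (MeasurableSet.iUnion hF)) (exists_abs_indicator_one_le _)
    (fun x => ?_) (fun x => ?_)
  · refine (Finset.abs_sum_le_sum_abs _ _).trans ?_
    refine (Finset.sum_le_card_nsmul _ _ 1 fun i _ => ?_).trans (by simp)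
    by_cases hx : x ∈ F i <;> simp [hx]
  · exact monotone_nat_of_le_succ fun n => by
      rw [Finset.sum_range_succ]
      exact le_add_of_nonneg_right (Set.indicator_nonneg (fun _ _ => zero_le_one) _)
  · refine HasSum.tendsto_sum_nat ?_
    by_cases hx : x ∈ ⋃ n, F n
    · obtain ⟨n, hn⟩ := mem_iUnion.1 hx
      have : ∀ i, i ≠ n → (F i).indicator (fun _ => (1 : ℝ)) x = 0 := fun i hi =>
        Set.indicator_of_notMem (fun h => Set.disjoint_left.1 (hd hi) h hn) _
      simpa [hx, hn] using hasSum_single n this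
    · have hx' : ∀ n, x ∉ F n := fun n hn => hx (mem_iUnion_of_mem n hn)
      simp [hx, hx', hasSum_zero]

/-- The measure `F ↦ L 1_F` induced by a monotonic functional `L`. -/
def measure (hL : IsMonotonicFunctional L) : Measure α :=
  Measure.ofMeasurable (fun F _ => ENNReal.ofReal (L (F.indicator fun _ => 1)))
    (by simp [hL.map_zero])
    (fun F hF hd => by
      have h := hL.hasSum_indicator hF hd
      rw [← h.tsum_eq, ENNReal.ofReal_tsum_of_nonneg (fun n => hL.indicator_nonneg (hF n))
        h.summable])

lemma measure_apply (hL : IsMonotonicFunctional L) {F : Set α} (hF : MeasurableSet F) :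
    hL.measure F = ENNReal.ofReal (L (F.indicator fun _ => 1)) :=
  Measure.ofMeasurable_apply F hF

/-- Integration against the measure induced by `L` is given by `L`. -/
lemma lintegral_measure (hL : IsMonotonicFunctional L) {f : α → ℝ≥0∞} (hf : Measurable f)
    (hb : ∃ C : ℝ≥0, ∀ x, f x ≤ C) :
    ∫⁻ x, f x ∂hL.measure = ENNReal.ofReal (L fun x => (f x).toReal) := by
  have bdd : ∀ {g : α → ℝ≥0∞} {C : ℝ≥0}, (∀ x, g x ≤ C) → ∃ C : ℝ, ∀ x, |(g x).toReal| ≤ C :=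
    fun {g C} h => ⟨C, fun x => by
      rw [abs_of_nonneg ENNReal.toReal_nonneg]
      exact ENNReal.toReal_mono ENNReal.coe_ne_top (h x)⟩
  revert hb
  refine Measurable.ennreal_induction (motive := fun f => (∃ C : ℝ≥0, ∀ x, f x ≤ C) →
    ∫⁻ x, f x ∂hL.measure = ENNReal.ofReal (L fun x => (f x).toReal))
    (fun c s hs => ?_) (fun f g _ hf hg ihf ihg => ?_) (fun f hf hmono ih => ?_) hf
  · rintro ⟨C, hC⟩
    rw [lintegral_indicator_const hs, hL.measure_apply hs]
    rcases s.eq_empty_or_nonempty with rfl | ⟨y, hy⟩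
    · simp [hL.map_zero]
    · have hc : c ≠ ∞ := ((by simpa [hy] using hC y : c ≤ C).trans_lt ENNReal.coe_lt_top).ne
      have : (fun x => (s.indicator (fun _ => c) x).toReal)
          = fun x => c.toReal * s.indicator (fun _ => (1 : ℝ)) x := by
        ext x; by_cases hx : x ∈ s <;> simp [hx]
      rw [this, hL.smul _ _ (measurable_const.indicator hs) (exists_abs_indicator_one_le s),
        ENNReal.ofReal_mul ENNReal.toReal_nonneg, ENNReal.ofReal_toReal hc]
  · rintro ⟨C, hC⟩
    have hfC : ∀ x, f x ≤ C := fun x => le_self_add.trans (hC x)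
    have hgC : ∀ x, g x ≤ C := fun x => le_add_self.trans (hC x)
    have : (fun x => ((f + g) x).toReal) = fun x => (f x).toReal + (g x).toReal := by
      ext x
      exact ENNReal.toReal_add ((hfC x).trans_lt ENNReal.coe_lt_top).ne
        ((hgC x).trans_lt ENNReal.coe_lt_top).ne
    rw [this, hL.add _ _ hf.ennreal_toReal (bdd hfC) hg.ennreal_toReal (bdd hgC),
      ENNReal.ofReal_add, ← ihf ⟨C, hfC⟩, ← ihg ⟨C, hgC⟩]
    · exact lintegral_add_left hf g
    · exact hL.nonneg _ hf.ennreal_toReal (bdd hfC) fun _ => ENNReal.toReal_nonneg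
    · exact hL.nonneg _ hg.ennreal_toReal (bdd hgC) fun _ => ENNReal.toReal_nonneg
  · rintro ⟨C, hC⟩
    have hfC : ∀ n x, f n x ≤ C := fun n x => (le_iSup (fun n => f n x) n).trans (hC x)
    have hlim := hL.tendsto (fun n x => (f n x).toReal) (fun x => (⨆ n, f n x).toReal)
      (fun n => (hf n).ennreal_toReal) (fun n => bdd (hfC n))
      (Measurable.iSup hf).ennreal_toReal (bdd hC)
      (fun x m n hmn => ENNReal.toReal_mono ((hfC n x).trans_lt ENNReal.coe_lt_top).ne
        (hmono hmn x))
      (fun x => (ENNReal.tendsto_toReal ((hC x).trans_lt ENNReal.coe_lt_top).ne).comp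
        (tendsto_atTop_iSup fun m n hmn => hmono hmn x))
    rw [lintegral_iSup hf hmono]
    refine tendsto_nhds_unique (tendsto_atTop_iSup fun m n hmn => lintegral_mono (hmono hmn)) ?_
    simp_rw [fun n => ih n ⟨C, hfC n⟩]
    exact (ENNReal.continuous_ofReal.tendsto _).comp hlim

end IsMonotonicFunctional

/-- Two right-continuous functions into a Hausdorff space which agree at `s` and at the points
of a dense set below `s` agree on `[0, s]`. -/
lemma IsCadlag.eq_of_le_of_dense {X : Type*} [TopologicalSpace X] [T2Space X] {f g : ℝ≥0 → X}
    (hf : IsCadlag f) (hg : IsCadlag g) {D : Set ℝ≥0} (hD : Dense D) {s : ℝ≥0}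
    (hs : f s = g s) (h : ∀ q ∈ D, q < s → f q = g q) {r : ℝ≥0} (hr : r ≤ s) : f r = g r := by
  rcases hr.eq_or_lt with rfl | hr
  · exact hs
  refine tendsto_nhds_unique_of_frequently_eq (hf.1 r) (hg.1 r) ?_
  rw [(nhdsGE_basis r).frequently_iff]
  intro u hu
  obtain ⟨q, hqD, hrq, hqu⟩ := hD.exists_between (lt_min hr hu)
  exact ⟨q, ⟨hrq.le, hqu.trans_le (min_le_right _ _)⟩, h q hqD (hqu.trans_le (min_le_left _ _))⟩

lemma Fot_le (t : ℝ≥0) : Fot E t ≤ instPathOmegaMS E :=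
  iSup₂_le fun r _ => le_iSup (fun r : ℝ≥0 =>
    MeasurableSpace.comap (fun ω : PathOmega E => ω.1 r) inferInstance) r

variable {E}

lemma measurable_Fot_eval {r t : ℝ≥0} (h : r ≤ t) :
    Measurable[Fot E t] fun ω : PathOmega E => ω.1 r := by
  rw [measurable_iff_comap_le]
  exact le_iSup₂ (f := fun (r : ℝ≥0) (_ : r ∈ Set.Iic t) =>
    MeasurableSpace.comap (fun ω : PathOmega E => ω.1 r) inferInstance) r h

lemma measurableSet_Fot_eq_on_Iic [T2Space E] [MeasurableSingletonClass E]
    (s : ℝ≥0) (η : PathOmega E) :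
    MeasurableSet[Fot E s] {ω : PathOmega E | ∀ r ≤ s, ω.1 r = η.1 r} := by
  obtain ⟨D, hDc, hD⟩ := TopologicalSpace.exists_countable_dense ℝ≥0
  have : {ω : PathOmega E | ∀ r ≤ s, ω.1 r = η.1 r}
      = (fun ω : PathOmega E => ω.1 s) ⁻¹' {η.1 s} ∩
        ⋂ q ∈ D ∩ Iio s, (fun ω : PathOmega E => ω.1 q) ⁻¹' {η.1 q} := by
    ext ω
    simp only [mem_ofPred_eq, mem_inter_iff, mem_preimage, mem_singleton_iff, mem_iInter, mem_Iio]
    exact ⟨fun h => ⟨h s le_rfl, fun q hq => h q hq.2.le⟩, fun h r hr =>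
      ω.2.eq_of_le_of_dense η.2 hD h.1 (fun q hq hqs => h.2 q ⟨hq, hqs⟩) hr⟩
  rw [this]
  refine MeasurableSet.inter (measurable_Fot_eval le_rfl (measurableSet_singleton _)) ?_
  exact MeasurableSet.biInter (hDc.mono inter_subset_left) fun q hq =>
    measurable_Fot_eval (le_of_lt hq.2) (measurableSet_singleton _)

lemma BB_indicator_one {F : Set (PathOmega E)} (hF : MeasurableSet F) :
    BB E (F.indicator fun _ => (1 : ℝ)) :=
  ⟨measurable_const.indicator hF, exists_abs_indicator_one_le F⟩

namespace IsProjSystem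

variable {Q : ℝ≥0 → (PathOmega E → ℝ) → PathOmega E → ℝ}

lemma isMonotonicFunctional (hQ : IsProjSystem E Q) (s : ℝ≥0) (η : PathOmega E) :
    IsMonotonicFunctional fun f => Q s f η where
  add f g hf hfb hg hgb := congrFun (hQ.add s f g ⟨hf, hfb⟩ ⟨hg, hgb⟩) η
  smul c f hf hfb := congrFun (hQ.smul s c f ⟨hf, hfb⟩) η
  nonneg f hf hfb h := hQ.pos s f ⟨hf, hfb⟩ h η
  tendsto f g hf hfb hg hgb hm hlim :=
    hQ.monotonic s f g (fun n => ⟨hf n, hfb n⟩) ⟨hg, hgb⟩ hm hlim η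

/-- The measure `F ↦ P_s[1_F](η)`. -/
def measure (hQ : IsProjSystem E Q) (s : ℝ≥0) (η : PathOmega E) : Measure (PathOmega E) :=
  (hQ.isMonotonicFunctional s η).measure

lemma measure_apply (hQ : IsProjSystem E Q) (s : ℝ≥0) (η : PathOmega E)
    {F : Set (PathOmega E)} (hF : MeasurableSet F) :
    hQ.measure s η F = ENNReal.ofReal (Q s (F.indicator fun _ => (1 : ℝ)) η) :=
  (hQ.isMonotonicFunctional s η).measure_apply hF

lemma measure_apply_of_Fot (hQ : IsProjSystem E Q) (s : ℝ≥0) (η : PathOmega E)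
    {G : Set (PathOmega E)} (hG : MeasurableSet[Fot E s] G) :
    hQ.measure s η G = G.indicator (fun _ => 1) η := by
  rw [hQ.measure_apply s η (Fot_le E s G hG),
    hQ.restrict_id s _ ⟨Measurable.indicator measurable_const hG, exists_abs_indicator_one_le G⟩]
  by_cases hη : η ∈ G <;> simp [hη]

instance isProbabilityMeasure_measure (hQ : IsProjSystem E Q) (s : ℝ≥0) (η : PathOmega E) :
    IsProbabilityMeasure (hQ.measure s η) :=
  ⟨by simpa using hQ.measure_apply_of_Fot s η MeasurableSet.univ⟩

lemma measurable_measure_apply (hQ : IsProjSystem E Q) (s : ℝ≥0) {F : Set (PathOmega E)}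
    (hF : MeasurableSet F) : Measurable[Fot E s] fun η => hQ.measure s η F := by
  simp_rw [fun η => hQ.measure_apply s η hF]
  exact ENNReal.measurable_ofReal.comp (hQ.mapsTo s _ (BB_indicator_one hF)).1

lemma measure_inter_of_Fot (hQ : IsProjSystem E Q) (t : ℝ≥0) (ω : PathOmega E)
    (F : Set (PathOmega E)) {G : Set (PathOmega E)} (hG : MeasurableSet[Fot E t] G) :
    hQ.measure t ω (F ∩ G) = G.indicator (fun ω => hQ.measure t ω F) ω := by
  have h := hQ.measure_apply_of_Fot t ω hG
  by_cases hω : ω ∈ G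
  · rw [indicator_of_mem hω] at h ⊢
    exact measure_inter_conull ((prob_compl_eq_zero_iff (Fot_le E t G hG)).2 h)
  · rw [indicator_of_notMem hω] at h ⊢
    exact measure_mono_null inter_subset_right h

lemma lintegral_measure_apply (hQ : IsProjSystem E Q) {s t : ℝ≥0} (hst : s ≤ t)
    (η : PathOmega E) {F : Set (PathOmega E)} (hF : MeasurableSet F) :
    ∫⁻ ω, hQ.measure t ω F ∂(hQ.measure s η) = hQ.measure s η F := by
  have hint := (hQ.isMonotonicFunctional s η).lintegral_measure
    ((hQ.measurable_measure_apply t hF).mono (Fot_le E t) le_rfl)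
    ⟨1, fun ω => by simpa using prob_le_one⟩
  have hfun : (fun ω => (hQ.measure t ω F).toReal) = Q t (F.indicator fun _ => (1 : ℝ)) := by
    ext ω
    rw [hQ.measure_apply t ω hF, ENNReal.toReal_ofReal
      ((hQ.isMonotonicFunctional t ω).indicator_nonneg hF)]
  rw [hfun, hQ.comp s t hst _ (BB_indicator_one hF), ← hQ.measure_apply s η hF] at hint
  exact hint

lemma setLIntegral_measure_apply (hQ : IsProjSystem E Q) {s t : ℝ≥0} (hst : s ≤ t)
    (η : PathOmega E) {F G : Set (PathOmega E)} (hF : MeasurableSet F)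
    (hG : MeasurableSet[Fot E t] G) :
    ∫⁻ ω in G, hQ.measure t ω F ∂(hQ.measure s η) = hQ.measure s η (F ∩ G) := by
  have hG' : MeasurableSet G := Fot_le E t G hG
  rw [← lintegral_indicator hG', ← hQ.lintegral_measure_apply hst η (hF.inter hG')]
  exact lintegral_congr fun ω => (hQ.measure_inter_of_Fot t ω F hG).symm

end IsProjSystem

variable (E)

/-- Proposition 2.10: given a path-dependent system of
projectors `(P_s)`, the set functions `F ↦ P_s[1_F](η)` are probability
measures `ℙ^{s,η}`, and the family `(ℙ^{s,η})` is a path-dependent canonical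
class. -/
theorem projSystem_measures [PolishSpace E] [BorelSpace E]
    (Q : ℝ≥0 → (PathOmega E → ℝ) → PathOmega E → ℝ)
    (hQ : IsProjSystem E Q) :
    ∃ P : ℝ≥0 → PathOmega E → Measure (PathOmega E),
      (∀ (s : ℝ≥0) (η : PathOmega E) (F : Set (PathOmega E)), MeasurableSet F →
        P s η F = ENNReal.ofReal (Q s (F.indicator fun _ => (1 : ℝ)) η)) ∧
      IsPathCanonicalClass P := by
  refine ⟨hQ.measure, fun s η F hF => hQ.measure_apply s η hF, inferInstance, fun s η => ?_,
    fun s F hF => hQ.measurable_measure_apply s hF,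
    fun s η t hst F hF G hG => hQ.setLIntegral_measure_apply hst η hF hG⟩
  simpa using hQ.measure_apply_of_Fot s η (measurableSet_Fot_eq_on_Iic s η)
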